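/- arXiv:2111.04894 — 5 statements merged into one kernel-verified Lean document; each statement's English description precedes it below -/
import Mathlib

section
/- Let W be a symmetric positive definite real d×d matrix, let β ≥ 0, let μ : ℝ → ℝ be a strictly increasing function taking values in [0, 1], let h ∈ ℝ, and let θ*, θ̃ ∈ ℝ^d. Assume: (i) for every φ ∈ ℝ^d with ‖φ‖ ≤ 1, |μ(⟨φ, θ*⟩) − μ(⟨φ, θ̃⟩)| ≤ β·‖φ‖_{W⁻¹}; and (ii) there exists φ₀ ∈ ℝ^d with ‖φ₀‖ ≤ 1 such that μ(⟨φ₀, θ*⟩) ≥ h. Then μ(‖θ̃‖) + β·√(λ_max(W⁻¹)) ≥ h. -/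
open Matrix

/-- Euclidean norm of a vector in `ℝ^d`. -/
noncomputable def eNorm {d : ℕ} (x : Fin d → ℝ) : ℝ := Real.sqrt (x ⬝ᵥ x)

/-- Weighted norm `‖x‖_W = √(xᵀ W x)`. -/
noncomputable def wNorm {d : ℕ} (W : Matrix (Fin d) (Fin d) ℝ) (x : Fin d → ℝ) : ℝ :=
  Real.sqrt (x ⬝ᵥ (W *ᵥ x))

/-- Largest eigenvalue of a symmetric (Hermitian) real matrix. -/
noncomputable def maxEig {d : ℕ} {W : Matrix (Fin d) (Fin d) ℝ} (hW : W.IsHermitian) : ℝ :=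
  ⨆ i, hW.eigenvalues i

/-- Smallest eigenvalue of a symmetric (Hermitian) real matrix. -/
noncomputable def minEig {d : ℕ} {W : Matrix (Fin d) (Fin d) ℝ} (hW : W.IsHermitian) : ℝ :=
  ⨅ i, hW.eigenvalues i

theorem eNorm_eq_norm_toLp {d : ℕ} (x : Fin d → ℝ) : eNorm x = ‖WithLp.toLp 2 x‖ := by
  simp [eNorm, EuclideanSpace.norm_eq, dotProduct, sq]

theorem dotProduct_le_eNorm_mul_eNorm {d : ℕ} (x y : Fin d → ℝ) :
    x ⬝ᵥ y ≤ eNorm x * eNorm y := by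
  rw [eNorm_eq_norm_toLp, eNorm_eq_norm_toLp]
  simpa [EuclideanSpace.inner_eq_star_dotProduct, dotProduct_comm] using
    real_inner_le_norm (WithLp.toLp 2 x) (WithLp.toLp 2 y)

/-- The quadratic form of a symmetric matrix is bounded by its largest eigenvalue. -/
theorem dotProduct_mulVec_le_maxEig_mul {d : ℕ} {A : Matrix (Fin d) (Fin d) ℝ}
    (hA : A.IsHermitian) (x : Fin d → ℝ) : x ⬝ᵥ (A *ᵥ x) ≤ maxEig hA * (x ⬝ᵥ x) := by
  have expand (y : Fin d → ℝ) :
      x ⬝ᵥ y = ∑ i, (x ⬝ᵥ ⇑(hA.eigenvectorBasis i)) * (y ⬝ᵥ ⇑(hA.eigenvectorBasis i)) := by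
    simpa [EuclideanSpace.inner_eq_star_dotProduct, dotProduct_comm] using
      (hA.eigenvectorBasis.sum_inner_mul_inner (WithLp.toLp 2 x) (WithLp.toLp 2 y)).symm
  have eigen (i : Fin d) : (A *ᵥ x) ⬝ᵥ ⇑(hA.eigenvectorBasis i) =
      hA.eigenvalues i * (x ⬝ᵥ ⇑(hA.eigenvectorBasis i)) := by
    have hT : Aᵀ = A := by simpa using hA.eq
    rw [dotProduct_comm, dotProduct_mulVec, ← mulVec_transpose, hT, hA.mulVec_eigenvectorBasis,
      smul_dotProduct, smul_eq_mul, dotProduct_comm x]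
  rw [expand (A *ᵥ x), expand x, Finset.mul_sum]
  refine Finset.sum_le_sum fun i _ => ?_
  rw [eigen, mul_left_comm]
  exact mul_le_mul_of_nonneg_right
    (le_ciSup (Set.finite_range hA.eigenvalues).bddAbove i) (mul_self_nonneg _)

theorem maxEig_nonneg {d : ℕ} {A : Matrix (Fin d) (Fin d) ℝ} (hA : A.PosSemidef) :
    0 ≤ maxEig hA.isHermitian :=
  Real.iSup_nonneg hA.eigenvalues_nonneg

theorem wNorm_le_sqrt_maxEig {d : ℕ} {A : Matrix (Fin d) (Fin d) ℝ} (hA : A.PosSemidef)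
    {x : Fin d → ℝ} (hx : eNorm x ≤ 1) : wNorm A x ≤ √(maxEig hA.isHermitian) := by
  refine Real.sqrt_le_sqrt ((dotProduct_mulVec_le_maxEig_mul hA.isHermitian x).trans ?_)
  exact mul_le_of_le_one_right (maxEig_nonneg hA) (Real.sqrt_le_one.mp hx)

/-- **Lemma 3.** Under the maximum-likelihood confidence event, if some unit-ball
feature `φ₀` satisfies `μ(⟨φ₀, θ*⟩) ≥ h` (the a priori safe state), then the optimistic
upper safety bound satisfies `μ(‖θ̃‖) + β·√(λ_max(W⁻¹)) ≥ h`. -/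
theorem optimistic_bound_ge_threshold {d : ℕ} (W : Matrix (Fin d) (Fin d) ℝ) (hW : W.PosDef)
    (β : ℝ) (hβ : 0 ≤ β) (μ : ℝ → ℝ) (hμ : StrictMono μ)
    (hμ01 : ∀ x, μ x ∈ Set.Icc (0 : ℝ) 1) (h : ℝ) (θs θt : Fin d → ℝ)
    (hconf : ∀ φ : Fin d → ℝ, eNorm φ ≤ 1 →
      |μ (φ ⬝ᵥ θs) - μ (φ ⬝ᵥ θt)| ≤ β * wNorm W⁻¹ φ)
    (hsafe : ∃ φ₀ : Fin d → ℝ, eNorm φ₀ ≤ 1 ∧ h ≤ μ (φ₀ ⬝ᵥ θs)) :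
    h ≤ μ (eNorm θt) + β * Real.sqrt (maxEig hW.isHermitian.inv) := by
  obtain ⟨φ, hφ, hh⟩ := hsafe
  have hw : wNorm W⁻¹ φ ≤ √(maxEig hW.isHermitian.inv) :=
    wNorm_le_sqrt_maxEig hW.inv.posSemidef hφ
  have hinner : φ ⬝ᵥ θt ≤ eNorm θt :=
    (dotProduct_le_eNorm_mul_eNorm φ θt).trans
      (mul_le_of_le_one_left (Real.sqrt_nonneg _) hφ)
  calc
    h ≤ μ (φ ⬝ᵥ θs) := hh
    _ ≤ μ (φ ⬝ᵥ θt) + β * wNorm W⁻¹ φ := by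
      linarith [(le_abs_self _).trans (hconf φ hφ)]
    _ ≤ μ (eNorm θt) + β * √(maxEig hW.isHermitian.inv) :=
      add_le_add (hμ.monotone hinner) (mul_le_mul_of_nonneg_left hw hβ)
end

section
/- Let d ≥ 1, t ≥ 1, H ≥ 1 be integers and let φ_1, …, φ_{t+H} ∈ ℝ^d satisfy ‖φ_τ‖ ≤ 1 for every τ. For each τ define W_τ = Σ_{s=1}^{τ} φ_s φ_sᵀ. Assume λ_min(W_t) ≥ 1 (in particular W_τ is invertible for every τ ≥ t, and necessarily t ≥ d). Then Σ_{τ=t+1}^{t+H} ‖φ_τ‖_{W_τ⁻¹} ≤ √( 2·H·d·log((t+H)/d) ). -/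
open Matrix

/-- A sum of real outer products `φ_s φ_sᵀ` is a symmetric (Hermitian) matrix. -/
lemma outerSum_isHermitian {ι : Type*} {d : ℕ} (φ : ι → Fin d → ℝ) (T : Finset ι) :
    (∑ s ∈ T, vecMulVec (φ s) (φ s)).IsHermitian := by
  unfold Matrix.IsHermitian
  ext i j
  simp only [Matrix.conjTranspose_apply, Matrix.sum_apply, Matrix.vecMulVec_apply, star_trivial]
  exact Finset.sum_congr rfl fun s _ => mul_comm _ _

lemma det_sub_vecMulVec {n : Type*} [Fintype n] [DecidableEq n] {A : Matrix n n ℝ}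
    (hA : IsUnit A.det) (u v : n → ℝ) :
    (A - vecMulVec u v).det = A.det * (1 - v ⬝ᵥ (A⁻¹ *ᵥ u)) := by
  have h : A - vecMulVec u v =
      A * (1 + replicateCol Unit (A⁻¹ *ᵥ (-u)) * replicateRow Unit v) := by
    rw [← vecMulVec_eq, mul_add, mul_one, mul_vecMulVec, mulVec_mulVec, mul_nonsing_inv _ hA,
      one_mulVec, neg_vecMulVec, sub_eq_add_neg]
  rw [h, det_mul, det_one_add_replicateCol_mul_replicateRow, mulVec_neg, dotProduct_neg,
    ← sub_eq_add_neg]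

lemma dotProduct_inv_mulVec_le_log_det {n : Type*} [Fintype n] [DecidableEq n]
    {A : Matrix n n ℝ} (hA : A.PosDef) (v : n → ℝ) :
    v ⬝ᵥ ((A + vecMulVec v v)⁻¹ *ᵥ v) ≤
      Real.log (A + vecMulVec v v).det - Real.log A.det := by
  have hB : (A + vecMulVec v v).PosDef :=
    hA.add_posSemidef (by simpa using posSemidef_vecMulVec_self_star v)
  have hdet := det_sub_vecMulVec hB.det_pos.ne'.isUnit v v
  rw [add_sub_cancel_right] at hdet
  have h := Real.one_sub_inv_le_log_of_pos (div_pos hB.det_pos hA.det_pos)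
  rw [Real.log_div hB.det_pos.ne' hA.det_pos.ne', inv_div] at h
  have hratio : A.det / (A + vecMulVec v v).det =
      1 - v ⬝ᵥ ((A + vecMulVec v v)⁻¹ *ᵥ v) := by
    rw [div_eq_iff hB.det_pos.ne', mul_comm, ← hdet]
  linarith

/-- The determinant–trace inequality, in logarithmic form. -/
lemma Matrix.PosDef.log_det_le {n : Type*} [Fintype n] [DecidableEq n] {A : Matrix n n ℝ}
    (hA : A.PosDef) {c : ℝ} (hc : 0 < c) (htr : A.trace ≤ Fintype.card n * c) :
    Real.log A.det ≤ Fintype.card n * Real.log c := by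
  have hlog (i : n) : Real.log (hA.1.eigenvalues i) ≤
      hA.1.eigenvalues i / c - 1 + Real.log c := by
    have h := Real.log_le_sub_one_of_pos (div_pos (hA.eigenvalues_pos i) hc)
    rw [Real.log_div (hA.eigenvalues_pos i).ne' hc.ne'] at h
    linarith
  have htr' : A.trace / c ≤ Fintype.card n := (div_le_iff₀ hc).2 htr
  have hsum : A.trace = ∑ i, hA.1.eigenvalues i := by
    simpa using hA.1.trace_eq_sum_eigenvalues
  have hprod : A.det = ∏ i, hA.1.eigenvalues i := by
    simpa using hA.1.det_eq_prod_eigenvalues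
  calc Real.log A.det = ∑ i, Real.log (hA.1.eigenvalues i) := by
        rw [hprod, Real.log_prod fun i _ => (hA.eigenvalues_pos i).ne']
    _ ≤ ∑ i, (hA.1.eigenvalues i / c - 1 + Real.log c) := Finset.sum_le_sum fun i _ => hlog i
    _ = A.trace / c - Fintype.card n + Fintype.card n * Real.log c := by
        simp [Finset.sum_add_distrib, Finset.sum_sub_distrib, ← Finset.sum_div, hsum]
    _ ≤ Fintype.card n * Real.log c := by linarith

lemma one_le_eigenvalues_of_one_le_minEig {d : ℕ} {W : Matrix (Fin d) (Fin d) ℝ}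
    {hW : W.IsHermitian} (h : 1 ≤ minEig hW) (i : Fin d) : 1 ≤ hW.eigenvalues i :=
  h.trans (ciInf_le (Set.finite_range _).bddBelow i)

lemma one_le_det_of_one_le_minEig {d : ℕ} {W : Matrix (Fin d) (Fin d) ℝ}
    {hW : W.IsHermitian} (h : 1 ≤ minEig hW) : 1 ≤ W.det := by
  have hprod : W.det = ∏ i, hW.eigenvalues i := by simpa using hW.det_eq_prod_eigenvalues
  rw [hprod]
  exact Finset.prod_induction _ (fun x => 1 ≤ x) (fun _ _ => one_le_mul_of_one_le_of_one_le) le_rfl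
    fun i _ => one_le_eigenvalues_of_one_le_minEig h i

lemma posDef_of_one_le_minEig {d : ℕ} {W : Matrix (Fin d) (Fin d) ℝ}
    {hW : W.IsHermitian} (h : 1 ≤ minEig hW) : W.PosDef :=
  hW.posDef_iff_eigenvalues_pos.2 fun i =>
    zero_lt_one.trans_le (one_le_eigenvalues_of_one_le_minEig h i)

lemma sum_Icc_vecMulVec_succ {d : ℕ} (φ : ℕ → Fin d → ℝ) (k : ℕ) :
    ∑ s ∈ Finset.Icc 1 (k + 1), vecMulVec (φ s) (φ s) =
      ∑ s ∈ Finset.Icc 1 k, vecMulVec (φ s) (φ s) + vecMulVec (φ (k + 1)) (φ (k + 1)) :=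
  Finset.sum_Icc_succ_top (by omega) _

lemma posDef_sum_Icc_vecMulVec {d t : ℕ} {φ : ℕ → Fin d → ℝ}
    (h : (∑ s ∈ Finset.Icc 1 t, vecMulVec (φ s) (φ s)).PosDef) (k : ℕ) :
    (∑ s ∈ Finset.Icc 1 (t + k), vecMulVec (φ s) (φ s)).PosDef := by
  induction k with
  | zero => exact h
  | succ k ih =>
    rw [← add_assoc, sum_Icc_vecMulVec_succ]
    exact ih.add_posSemidef (by simpa using posSemidef_vecMulVec_self_star (φ (t + k + 1)))

/-- Telescoping the log-determinant bounds the sum of squared weighted norms. -/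
lemma sum_dotProduct_inv_mulVec_le_log_det {d t : ℕ} {φ : ℕ → Fin d → ℝ}
    (h : (∑ s ∈ Finset.Icc 1 t, vecMulVec (φ s) (φ s)).PosDef) (H : ℕ) :
    ∑ τ ∈ Finset.Icc (t + 1) (t + H),
        φ τ ⬝ᵥ ((∑ s ∈ Finset.Icc 1 τ, vecMulVec (φ s) (φ s))⁻¹ *ᵥ φ τ) ≤
      Real.log (∑ s ∈ Finset.Icc 1 (t + H), vecMulVec (φ s) (φ s)).det -
        Real.log (∑ s ∈ Finset.Icc 1 t, vecMulVec (φ s) (φ s)).det := by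
  induction H with
  | zero => simp
  | succ k ih =>
    rw [← add_assoc, Finset.sum_Icc_succ_top (by omega), sum_Icc_vecMulVec_succ]
    have hstep := dotProduct_inv_mulVec_le_log_det (posDef_sum_Icc_vecMulVec h k) (φ (t + k + 1))
    linarith

lemma trace_sum_Icc_vecMulVec_le {d n : ℕ} {φ : ℕ → Fin d → ℝ}
    (hφ : ∀ τ ∈ Finset.Icc 1 n, eNorm (φ τ) ≤ 1) :
    (∑ s ∈ Finset.Icc 1 n, vecMulVec (φ s) (φ s)).trace ≤ n := by
  rw [trace_sum]
  calc ∑ s ∈ Finset.Icc 1 n, (vecMulVec (φ s) (φ s)).trace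
      ≤ ∑ s ∈ Finset.Icc 1 n, (1 : ℝ) := Finset.sum_le_sum fun s hs => by
        rw [trace_vecMulVec]
        exact Real.sqrt_le_one.1 (hφ s hs)
    _ = n := by simp

lemma wNorm_inv_sq {d : ℕ} {W : Matrix (Fin d) (Fin d) ℝ} (hW : W.PosDef) (x : Fin d → ℝ) :
    wNorm W⁻¹ x ^ 2 = x ⬝ᵥ (W⁻¹ *ᵥ x) :=
  Real.sq_sqrt (by simpa using hW.inv.posSemidef.dotProduct_mulVec_nonneg x)

/-- **Elliptical potential bound (second conclusion of Lemma 4).** If the design matrix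
`W_t = Σ_{s=1}^t φ_s φ_sᵀ` satisfies `λ_min(W_t) ≥ 1`, then the cumulative weighted norms
over the next `H` steps satisfy
`Σ_{τ=t+1}^{t+H} ‖φ_τ‖_{W_τ⁻¹} ≤ √(2·H·d·log((t+H)/d))`. -/
theorem elliptical_potential_bound {d t H : ℕ} (hd : 1 ≤ d) (ht : 1 ≤ t) (hH : 1 ≤ H)
    (φ : ℕ → Fin d → ℝ) (hφ : ∀ τ ∈ Finset.Icc 1 (t + H), eNorm (φ τ) ≤ 1)
    (hmin : 1 ≤ minEig (outerSum_isHermitian φ (Finset.Icc 1 t))) :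
    ∑ τ ∈ Finset.Icc (t + 1) (t + H),
        wNorm (∑ s ∈ Finset.Icc 1 τ, vecMulVec (φ s) (φ s))⁻¹ (φ τ) ≤
      Real.sqrt (2 * (H : ℝ) * (d : ℝ) * Real.log (((t : ℝ) + (H : ℝ)) / (d : ℝ))) := by
  have hW := posDef_of_one_le_minEig hmin
  have hd0 : (0 : ℝ) < d := by exact_mod_cast hd
  have hc : (0 : ℝ) < ((t : ℝ) + H) / d := by positivity
  have htr : (∑ s ∈ Finset.Icc 1 (t + H), vecMulVec (φ s) (φ s)).trace ≤
      Fintype.card (Fin d) * (((t : ℝ) + H) / d) := by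
    rw [Fintype.card_fin, mul_div_cancel₀ _ hd0.ne']
    exact_mod_cast trace_sum_Icc_vecMulVec_le hφ
  have hlogdet := (posDef_sum_Icc_vecMulVec hW H).log_det_le hc htr
  rw [Fintype.card_fin] at hlogdet
  have hlogdet₀ := Real.log_nonneg (one_le_det_of_one_le_minEig hmin)
  have hsq : ∑ τ ∈ Finset.Icc (t + 1) (t + H),
      wNorm (∑ s ∈ Finset.Icc 1 τ, vecMulVec (φ s) (φ s))⁻¹ (φ τ) ^ 2 ≤
        d * Real.log (((t : ℝ) + H) / d) := by
    refine (Finset.sum_congr rfl fun τ hτ => ?_).trans_le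
      ((sum_dotProduct_inv_mulVec_le_log_det hW H).trans (by linarith))
    obtain ⟨k, rfl⟩ := Nat.exists_eq_add_of_le ((Nat.le_succ t).trans (Finset.mem_Icc.1 hτ).1)
    exact wNorm_inv_sq (posDef_sum_Icc_vecMulVec hW k) _
  have hnonneg := (Finset.sum_nonneg fun τ _ => sq_nonneg _).trans hsq
  have hcard : ((Finset.Icc (t + 1) (t + H)).card : ℝ) = H := by simp
  apply Real.le_sqrt_of_sq_le
  refine sq_sum_le_card_mul_sum_sq.trans ?_
  rw [hcard]
  have hHsq := mul_le_mul_of_nonneg_left hsq (Nat.cast_nonneg (α := ℝ) H)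
  have hH0 := mul_nonneg (Nat.cast_nonneg (α := ℝ) H) hnonneg
  linarith
end

section
/- Let S be a nonempty finite set, γ ∈ [0,1), and let A, B : S → Finset S assign to each state nonempty sets of admissible successor states with B(s) ⊆ A(s) for every s ∈ S. Let R, r : S → ℝ satisfy R(s′) ≥ r(s′) for every s′ belonging to ⋃_{s ∈ S} B(s). Suppose J, V : S → ℝ satisfy the Bellman equations J(s) = max_{s′ ∈ A(s)} [ R(s′) + γ·J(s′) ] and V(s) = max_{s′ ∈ B(s)} [ r(s′) + γ·V(s′) ] for every s ∈ S. Then J(s) ≥ V(s) for every s ∈ S. -/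
/-- **Optimism lemma (Appendix D, `J* ≥ V*`).** Let `S` be a nonempty finite state set,
`γ ∈ [0,1)` the discount factor, `A, B : S → Finset S` nonempty successor sets with
`B(s) ⊆ A(s)`, and `R, r : S → ℝ` with `R(s′) ≥ r(s′)` on `⋃_s B(s)`. If `J` and `V`
satisfy the Bellman equations `J(s) = max_{s′ ∈ A(s)} [R(s′) + γ·J(s′)]` and
`V(s) = max_{s′ ∈ B(s)} [r(s′) + γ·V(s′)]`, then `J(s) ≥ V(s)` for every `s`. -/
theorem optimistic_value_ge {S : Type*} [Fintype S] [Nonempty S]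
    (γ : ℝ) (hγ0 : 0 ≤ γ) (hγ1 : γ < 1)
    (A B : S → Finset S) (hA : ∀ s, (A s).Nonempty) (hB : ∀ s, (B s).Nonempty)
    (hBA : ∀ s, B s ⊆ A s) (R r : S → ℝ)
    (hRr : ∀ s' ∈ ⋃ s : S, (B s : Set S), r s' ≤ R s')
    (J V : S → ℝ)
    (hJ : ∀ s, J s = (A s).sup' (hA s) (fun s' => R s' + γ * J s'))
    (hV : ∀ s, V s = (B s).sup' (hB s) (fun s' => r s' + γ * V s')) :
    ∀ s, V s ≤ J s := by
  obtain ⟨m, hm⟩ := Finite.exists_max (fun s => V s - J s)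
  obtain ⟨t, ht, hVt⟩ := (B m).exists_mem_eq_sup' (hB m) (fun s' => r s' + γ * V s')
  have hVm : V m = r t + γ * V t := (hV m).trans hVt
  have hJm : R t + γ * J t ≤ J m :=
    (Finset.le_sup' (fun s' => R s' + γ * J s') (hBA m ht)).trans_eq (hJ m).symm
  have hrt : r t ≤ R t := hRr t (Set.mem_iUnion.2 ⟨m, ht⟩)
  have hγ : γ * (V t - J t) ≤ γ * (V m - J m) := mul_le_mul_of_nonneg_left (hm t) hγ0
  have hm0 : V m - J m ≤ 0 := by nlinarith
  exact fun s => sub_nonpos.1 ((hm s).trans hm0)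
end

section
/- Let (Ω, F, P) be a probability space, S a countable set, H ∈ ℕ, γ ∈ [0,1], V_max ≥ 0, and let s_0, s_1, …, s_H be S-valued random variables. Let Ω₀ ⊆ S and let r, r̂ : S → ℝ be bounded functions such that r(s) = r̂(s) for every s ∈ Ω₀ and r(s) ≥ 0 for every s ∈ S, and assume Σ_{τ=0}^{H} γ^τ r̂(s_τ) ≤ V_max almost surely. Let A be the event that s_τ ∉ Ω₀ for some 0 ≤ τ ≤ H. Then E[ Σ_{τ=0}^{H} γ^τ r(s_τ) ] ≥ E[ Σ_{τ=0}^{H} γ^τ r̂(s_τ) ] − V_max · P(A). -/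
open MeasureTheory

/-- A finite-horizon discounted return of a bounded reward on a countable state space is
integrable. -/
theorem integrable_discounted_return {Ω : Type*} [MeasurableSpace Ω] (P : Measure Ω)
    [IsFiniteMeasure P] {S : Type*} [MeasurableSpace S] [MeasurableSingletonClass S]
    [Countable S] (H : ℕ) (γ : ℝ) {s : ℕ → Ω → S} (hs : ∀ τ, Measurable (s τ)) {f : S → ℝ}
    (hf : ∃ C, ∀ x, |f x| ≤ C) :
    Integrable (fun ω => ∑ τ ∈ Finset.range (H + 1), γ ^ τ * f (s τ ω)) P := by
  obtain ⟨C, hC⟩ := hf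
  refine integrable_finsetSum _ fun τ _ => Integrable.const_mul ?_ _
  exact .of_bound ((measurable_of_countable f).comp (hs τ)).aestronglyMeasurable C
    (.of_forall fun ω => hC (s τ ω))

/-- **Generalized induced inequality (Appendix D, after Strehl–Littman).** If the bounded
rewards `r` and `r̂` agree on `Ω₀ ⊆ S`, `r ≥ 0`, and the discounted `r̂`-return is a.s.
at most `V_max`, then
`E[Σ_{τ=0}^H γ^τ r(s_τ)] ≥ E[Σ_{τ=0}^H γ^τ r̂(s_τ)] − V_max·P(∃ τ ≤ H, s_τ ∉ Ω₀)`. -/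
theorem generalized_induced_inequality {Ω : Type*} [MeasurableSpace Ω] (P : Measure Ω)
    [IsProbabilityMeasure P] {S : Type*} [MeasurableSpace S] [MeasurableSingletonClass S]
    [Countable S] (H : ℕ) (γ Vmax : ℝ) (hγ : γ ∈ Set.Icc (0 : ℝ) 1) (hVmax : 0 ≤ Vmax)
    (s : ℕ → Ω → S) (hs : ∀ τ, Measurable (s τ))
    (Ω₀ : Set S) (r rhat : S → ℝ)
    (hrbdd : ∃ C, ∀ x, |r x| ≤ C) (hrhatbdd : ∃ C, ∀ x, |rhat x| ≤ C)
    (hagree : ∀ x ∈ Ω₀, r x = rhat x) (hrnonneg : ∀ x, 0 ≤ r x)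
    (hVbound : ∀ᵐ ω ∂P, ∑ τ ∈ Finset.range (H + 1), γ ^ τ * rhat (s τ ω) ≤ Vmax) :
    ∫ ω, ∑ τ ∈ Finset.range (H + 1), γ ^ τ * r (s τ ω) ∂P ≥
      (∫ ω, ∑ τ ∈ Finset.range (H + 1), γ ^ τ * rhat (s τ ω) ∂P) -
        Vmax * (P {ω | ∃ τ ≤ H, s τ ω ∉ Ω₀}).toReal := by
  have measurableSet_escape : MeasurableSet {ω | ∃ τ ≤ H, s τ ω ∉ Ω₀} := by
    have h : {ω | ∃ τ ≤ H, s τ ω ∉ Ω₀} = ⋃ τ, ⋃ (_ : τ ≤ H), s τ ⁻¹' Ω₀ᶜ := by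
      ext ω
      simp
    rw [h]
    exact .iUnion fun τ => .iUnion fun _ => hs τ Ω₀.to_countable.measurableSet.compl
  set A := {ω | ∃ τ ≤ H, s τ ω ∉ Ω₀}
  have hr := integrable_discounted_return P H γ hs hrbdd
  have hrhat := integrable_discounted_return P H γ hs hrhatbdd
  have hind : Integrable (A.indicator fun _ => Vmax) P :=
    (integrable_const Vmax).indicator measurableSet_escape
  have integral_escape : ∫ ω, A.indicator (fun _ => Vmax) ω ∂P = Vmax * (P A).toReal := by
    rw [integral_indicator_const _ measurableSet_escape, smul_eq_mul, mul_comm, measureReal_def]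
  rw [ge_iff_le, ← integral_escape, ← integral_sub hrhat hind]
  refine integral_mono_ae (hrhat.sub hind) hr ?_
  filter_upwards [hVbound] with ω hω
  by_cases hmem : ω ∈ A
  · rw [Set.indicator_of_mem hmem]
    have : 0 ≤ ∑ τ ∈ Finset.range (H + 1), γ ^ τ * r (s τ ω) :=
      Finset.sum_nonneg fun τ _ => mul_nonneg (pow_nonneg hγ.1 τ) (hrnonneg _)
    linarith
  · rw [Set.indicator_of_notMem hmem, sub_zero]
    refine (Finset.sum_congr rfl fun τ hτ => ?_).le
    have hτ' : s τ ω ∈ Ω₀ := by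
      by_contra h
      exact hmem ⟨τ, Nat.lt_succ_iff.mp (Finset.mem_range.mp hτ), h⟩
    rw [hagree _ hτ']
end

section
/- Let d ≥ 1, t ≥ 1, H ≥ 1 be integers, β ≥ 0, γ ∈ [0,1], and let φ_{t+1}, …, φ_{t+H} ∈ ℝ^d with ‖φ_τ‖ ≤ 1 together with φ_1, …, φ_t ∈ ℝ^d with ‖φ_τ‖ ≤ 1 define W_τ = Σ_{s=1}^{τ} φ_s φ_sᵀ, and assume λ_min(W_t) ≥ 1. Let x_{t+1}, …, x_{t+H} be real numbers with |x_τ| ≤ β·‖φ_τ‖_{W_τ⁻¹} for every t+1 ≤ τ ≤ t+H. Then | Σ_{τ=t+1}^{t+H} γ^{τ−t} x_τ | ≤ β·√( 2·H·d·log((t+H)/d) ). -/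
open Matrix

/-- The determinant lemma for a symmetric rank-one update, written in terms of the updated
matrix. -/
lemma det_eq_det_update_mul {d : ℕ} {A : Matrix (Fin d) (Fin d) ℝ} (v : Fin d → ℝ)
    (h : IsUnit (A + vecMulVec v v).det) :
    A.det = (A + vecMulVec v v).det * (1 - v ⬝ᵥ ((A + vecMulVec v v)⁻¹ *ᵥ v)) := by
  have key := det_add_replicateCol_mul_replicateRow (ι := Unit) h (-v) v
  rw [← vecMulVec_eq, neg_vecMulVec, add_neg_cancel_right, det_unique (n := Unit),
    Matrix.add_apply, one_apply_eq,
    Matrix.mul_assoc, ← replicateCol_mulVec, replicateRow_mul_replicateCol_apply, mulVec_neg,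
    dotProduct_neg, ← sub_eq_add_neg] at key
  exact key

lemma Matrix.PosDef.add_vecMulVec_self {d : ℕ} {A : Matrix (Fin d) (Fin d) ℝ} (hA : A.PosDef)
    (v : Fin d → ℝ) : (A + vecMulVec v v).PosDef := by
  simpa using hA.add_posSemidef (posSemidef_vecMulVec_self_star v)

lemma dotProduct_inv_update_le_log_det {d : ℕ} {A : Matrix (Fin d) (Fin d) ℝ} (hA : A.PosDef)
    (v : Fin d → ℝ) :
    v ⬝ᵥ ((A + vecMulVec v v)⁻¹ *ᵥ v) ≤
      Real.log (A + vecMulVec v v).det - Real.log A.det := by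
  have hpos := hA.det_pos
  have hpos' := (hA.add_vecMulVec_self v).det_pos
  have hdet := det_eq_det_update_mul v hpos'.ne'.isUnit
  have hlog := Real.log_le_sub_one_of_pos (div_pos hpos hpos')
  rw [Real.log_div hpos.ne' hpos'.ne'] at hlog
  have hquot : A.det / (A + vecMulVec v v).det =
      1 - v ⬝ᵥ ((A + vecMulVec v v)⁻¹ *ᵥ v) := by
    rw [div_eq_iff hpos'.ne', mul_comm]
    exact hdet
  linarith

/-- The arithmetic-geometric mean inequality for the spectrum of a positive definite matrix. -/
lemma Matrix.PosDef.log_det_le_s12 {d : ℕ} (hd : 1 ≤ d) {A : Matrix (Fin d) (Fin d) ℝ}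
    (hA : A.PosDef) : Real.log A.det ≤ d * Real.log (A.trace / d) := by
  have hd0 : (0 : ℝ) < d := by exact_mod_cast hd
  have : Nonempty (Fin d) := ⟨⟨0, hd⟩⟩
  have htrace : A.trace = ∑ i, hA.isHermitian.eigenvalues i := by
    simpa using hA.isHermitian.trace_eq_sum_eigenvalues
  have hdet : A.det = ∏ i, hA.isHermitian.eigenvalues i := by
    simpa using hA.isHermitian.det_eq_prod_eigenvalues
  have hm : 0 < A.trace / d := by
    refine div_pos ?_ hd0
    rw [htrace]
    exact Finset.sum_pos (fun i _ => hA.eigenvalues_pos i) Finset.univ_nonempty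
  set m := A.trace / d with hmdef
  have hsum : ∑ i, hA.isHermitian.eigenvalues i = d * m := by
    rw [← htrace, hmdef]
    field_simp
  rw [hdet, Real.log_prod fun i _ => (hA.eigenvalues_pos i).ne']
  calc ∑ i, Real.log (hA.isHermitian.eigenvalues i)
      ≤ ∑ i, (Real.log m + (hA.isHermitian.eigenvalues i / m - 1)) := by
        refine Finset.sum_le_sum fun i _ => ?_
        have h := Real.log_le_sub_one_of_pos (div_pos (hA.eigenvalues_pos i) hm)
        rw [Real.log_div (hA.eigenvalues_pos i).ne' hm.ne'] at h
        linarith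
    _ = d * Real.log m := by
        rw [Finset.sum_add_distrib, Finset.sum_sub_distrib, ← Finset.sum_div, hsum]
        simp [hm.ne']

lemma trace_outerSum_le {d : ℕ} (φ : ℕ → Fin d → ℝ) (n : ℕ)
    (hφ : ∀ s ∈ Finset.Icc 1 n, eNorm (φ s) ≤ 1) :
    (∑ s ∈ Finset.Icc 1 n, vecMulVec (φ s) (φ s)).trace ≤ n := by
  rw [trace_sum]
  calc ∑ s ∈ Finset.Icc 1 n, (vecMulVec (φ s) (φ s)).trace ≤ ∑ s ∈ Finset.Icc 1 n, (1 : ℝ) := by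
        refine Finset.sum_le_sum fun s hs => ?_
        rw [trace_vecMulVec]
        exact Real.sqrt_le_one.mp (hφ s hs)
    _ = n := by simp

lemma one_le_eigenvalues_of_one_le_minEig_s12 {d : ℕ} {A : Matrix (Fin d) (Fin d) ℝ}
    (hA : A.IsHermitian) (h : 1 ≤ minEig hA) (i : Fin d) : 1 ≤ hA.eigenvalues i :=
  h.trans (ciInf_le (Set.finite_range _).bddBelow i)

lemma outerSum_posDef_and_sum_le_log_det {d : ℕ} (φ : ℕ → Fin d → ℝ) (t : ℕ)
    (hmin : 1 ≤ minEig (outerSum_isHermitian φ (Finset.Icc 1 t))) (n : ℕ) :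
    (∑ s ∈ Finset.Icc 1 (t + n), vecMulVec (φ s) (φ s)).PosDef ∧
    ∑ τ ∈ Finset.Icc (t + 1) (t + n),
        φ τ ⬝ᵥ ((∑ s ∈ Finset.Icc 1 τ, vecMulVec (φ s) (φ s))⁻¹ *ᵥ φ τ) ≤
      Real.log (∑ s ∈ Finset.Icc 1 (t + n), vecMulVec (φ s) (φ s)).det := by
  induction n with
  | zero =>
    have heig := one_le_eigenvalues_of_one_le_minEig_s12 _ hmin
    refine ⟨(outerSum_isHermitian φ _).posDef_iff_eigenvalues_pos.mpr
      fun i => one_pos.trans_le (heig i), ?_⟩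
    have hdet := (outerSum_isHermitian φ (Finset.Icc 1 t)).det_eq_prod_eigenvalues
    simp only [add_zero, Finset.Icc_eq_empty (show ¬ t + 1 ≤ t by omega), Finset.sum_empty]
    refine Real.log_nonneg ?_
    rw [hdet]
    simpa using Finset.prod_le_prod (s := Finset.univ) (fun _ _ => zero_le_one)
      fun i _ => heig i
  | succ n ih =>
    have hsplit : ∑ s ∈ Finset.Icc 1 (t + (n + 1)), vecMulVec (φ s) (φ s) =
        ∑ s ∈ Finset.Icc 1 (t + n), vecMulVec (φ s) (φ s) +
          vecMulVec (φ (t + n + 1)) (φ (t + n + 1)) :=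
      Finset.sum_Icc_succ_top (by omega) _
    refine ⟨hsplit ▸ ih.1.add_vecMulVec_self _, ?_⟩
    have h := dotProduct_inv_update_le_log_det ih.1 (φ (t + n + 1))
    rw [← hsplit] at h
    rw [← add_assoc, Finset.sum_Icc_succ_top (by omega)]
    linarith! [ih.2]

/-- **Equation (8) in the proof of Theorem 2.** If `λ_min(W_t) ≥ 1` and each
`x_τ` satisfies `|x_τ| ≤ β·‖φ_τ‖_{W_τ⁻¹}`, then the discounted sum over the horizon
satisfies `|Σ_{τ=t+1}^{t+H} γ^{τ−t} x_τ| ≤ β·√(2·H·d·log((t+H)/d))`. -/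
theorem discounted_bonus_bound {d t H : ℕ} (hd : 1 ≤ d) (ht : 1 ≤ t) (hH : 1 ≤ H)
    (β γ : ℝ) (hβ : 0 ≤ β) (hγ : γ ∈ Set.Icc (0 : ℝ) 1)
    (φ : ℕ → Fin d → ℝ) (hφ : ∀ τ ∈ Finset.Icc 1 (t + H), eNorm (φ τ) ≤ 1)
    (hmin : 1 ≤ minEig (outerSum_isHermitian φ (Finset.Icc 1 t)))
    (x : ℕ → ℝ)
    (hx : ∀ τ ∈ Finset.Icc (t + 1) (t + H),
      |x τ| ≤ β * wNorm (∑ s ∈ Finset.Icc 1 τ, vecMulVec (φ s) (φ s))⁻¹ (φ τ)) :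
    |∑ τ ∈ Finset.Icc (t + 1) (t + H), γ ^ (τ - t) * x τ| ≤
      β * Real.sqrt (2 * (H : ℝ) * (d : ℝ) * Real.log (((t : ℝ) + (H : ℝ)) / (d : ℝ))) := by
  obtain ⟨hpd, hsum⟩ := outerSum_posDef_and_sum_le_log_det φ t hmin H
  set W : ℕ → Matrix (Fin d) (Fin d) ℝ :=
    fun τ => ∑ s ∈ Finset.Icc 1 τ, vecMulVec (φ s) (φ s)
  have hd0 : (0 : ℝ) < d := by exact_mod_cast hd
  have : Nonempty (Fin d) := ⟨⟨0, hd⟩⟩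
  have hlog : Real.log (W (t + H)).det ≤ d * Real.log (((t : ℝ) + H) / d) := by
    refine (hpd.log_det_le_s12 hd).trans (mul_le_mul_of_nonneg_left ?_ hd0.le)
    refine Real.log_le_log (div_pos hpd.trace_pos hd0) ?_
    gcongr
    simpa using trace_outerSum_le φ (t + H) hφ
  have hq : ∀ τ ∈ Finset.Icc (t + 1) (t + H), 0 ≤ φ τ ⬝ᵥ ((W τ)⁻¹ *ᵥ φ τ) := by
    intro τ hτ
    obtain ⟨n, rfl⟩ := Nat.exists_eq_add_of_le (show t ≤ τ by grind)
    simpa using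
      (outerSum_posDef_and_sum_le_log_det φ t hmin n).1.inv.posSemidef.dotProduct_mulVec_nonneg
        (φ (t + n))
  have hS : 0 ≤ ∑ τ ∈ Finset.Icc (t + 1) (t + H), φ τ ⬝ᵥ ((W τ)⁻¹ *ᵥ φ τ) :=
    Finset.sum_nonneg hq
  have hcauchy : ∑ τ ∈ Finset.Icc (t + 1) (t + H), wNorm (W τ)⁻¹ (φ τ) ≤
      Real.sqrt (2 * (H : ℝ) * (d : ℝ) * Real.log (((t : ℝ) + (H : ℝ)) / (d : ℝ))) := by
    refine Real.le_sqrt_of_sq_le ?_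
    calc (∑ τ ∈ Finset.Icc (t + 1) (t + H), wNorm (W τ)⁻¹ (φ τ)) ^ 2
        ≤ (Finset.Icc (t + 1) (t + H)).card *
            ∑ τ ∈ Finset.Icc (t + 1) (t + H), wNorm (W τ)⁻¹ (φ τ) ^ 2 :=
          sq_sum_le_card_mul_sum_sq
      _ = H * ∑ τ ∈ Finset.Icc (t + 1) (t + H), φ τ ⬝ᵥ ((W τ)⁻¹ *ᵥ φ τ) := by
          congr 1
          · simp
          · exact Finset.sum_congr rfl fun τ hτ => Real.sq_sqrt (hq τ hτ)
      _ ≤ H * (2 * (d * Real.log (((t : ℝ) + H) / d))) := by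
          gcongr
          linarith
      _ = 2 * (H : ℝ) * (d : ℝ) * Real.log (((t : ℝ) + (H : ℝ)) / (d : ℝ)) := by ring
  calc |∑ τ ∈ Finset.Icc (t + 1) (t + H), γ ^ (τ - t) * x τ|
      ≤ ∑ τ ∈ Finset.Icc (t + 1) (t + H), |γ ^ (τ - t) * x τ| := Finset.abs_sum_le_sum_abs _ _
    _ ≤ ∑ τ ∈ Finset.Icc (t + 1) (t + H), β * wNorm (W τ)⁻¹ (φ τ) := by
        refine Finset.sum_le_sum fun τ hτ => ?_
        rw [abs_mul, abs_of_nonneg (pow_nonneg hγ.1 _)]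
        exact (mul_le_of_le_one_left (abs_nonneg _) (pow_le_one₀ hγ.1 hγ.2)).trans (hx τ hτ)
    _ = β * ∑ τ ∈ Finset.Icc (t + 1) (t + H), wNorm (W τ)⁻¹ (φ τ) := by
        rw [Finset.mul_sum]
    _ ≤ _ := mul_le_mul_of_nonneg_left hcauchy hβ
end
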